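/- Let $G$ be a projective nonlocal game with uniform input distribution, where Bob's input set has size $n \geq 2$. Let $\omega^*(G)$ denote its quantum value and $\omega^*(G_{cp})$ the quantum value of its coupled game. Then $\omega^*(G_{cp}) \geq \frac{n^2}{(n-1)^2}\,\omega^*(G)\,(\max\{0, \omega^*(G) - \tfrac{1}{n}\})^2$. -/

import Mathlib

open Matrix BigOperators ComplexOrder Kronecker

/-- A nonlocal game with uniform input distribution, given by its winning predicate. -/
structure Game (IA IB OA OB : Type) where
  W : IA → IB → OA → OB → Bool

/-- A quantum strategy: a shared state on `ℂ^{dA} ⊗ ℂ^{dB}` together with POVMs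
for Alice and Bob. -/
structure Strategy (IA IB OA OB : Type) [Fintype OA] [Fintype OB] where
  dA : ℕ
  dB : ℕ
  ρ : Matrix (Fin dA × Fin dB) (Fin dA × Fin dB) ℂ
  ρ_psd : ρ.PosSemidef
  ρ_tr : ρ.trace = 1
  Q : IA → OA → Matrix (Fin dA) (Fin dA) ℂ
  Q_psd : ∀ x a, (Q x a).PosSemidef
  Q_sum : ∀ x, ∑ a, Q x a = 1
  P : IB → OB → Matrix (Fin dB) (Fin dB) ℂ
  P_psd : ∀ y b, (P y b).PosSemidef
  P_sum : ∀ y, ∑ b, P y b = 1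

/-- Winning probability of a strategy in a game with uniform input distribution. -/
noncomputable def winProb {IA IB OA OB : Type}
    [Fintype IA] [Fintype IB] [Fintype OA] [Fintype OB]
    (G : Game IA IB OA OB) (S : Strategy IA IB OA OB) : ℝ :=
  ((Fintype.card IA : ℝ) * (Fintype.card IB : ℝ))⁻¹ *
    ∑ x, ∑ y, ∑ a, ∑ b,
      if G.W x y a b then (((S.Q x a ⊗ₖ S.P y b) * S.ρ).trace).re else 0

/-- The quantum value of a nonlocal game with uniform input distribution. -/
noncomputable def qValue {IA IB OA OB : Type}
    [Fintype IA] [Fintype IB] [Fintype OA] [Fintype OB]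
    (G : Game IA IB OA OB) : ℝ :=
  sSup {w : ℝ | ∃ S : Strategy IA IB OA OB, w = winProb G S}

/-- A game is projective if for each `(x, y, a)` there is a unique winning `b`. -/
def Game.Projective {IA IB OA OB : Type} (G : Game IA IB OA OB) : Prop :=
  ∀ x y a, ∃! b, G.W x y a b = true

/-- The coupled game: Bob receives two distinct inputs (uniformly at random) and
must win with respect to both. -/
def Game.coupled {IA IB OA OB : Type} [DecidableEq IB] (G : Game IA IB OA OB) :
    Game IA {p : IB × IB // p.1 ≠ p.2} OA (OB × OB) where
  W := fun x y a b => G.W x y.1.1 a b.1 && G.W x y.1.2 a b.2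

lemma sum_ne_eq {IB : Type} [Fintype IB] [DecidableEq IB] (F : IB → IB → ℝ) :
    ∑ p : {p : IB × IB // p.1 ≠ p.2}, F p.1.1 p.1.2 = (∑ y, ∑ z, F y z) - ∑ y, F y y := by
  have h1 : ∑ p : {p : IB × IB // p.1 ≠ p.2}, F p.1.1 p.1.2
      = ∑ p : IB × IB, if p.1 ≠ p.2 then F p.1 p.2 else 0 := by
    rw [← Finset.sum_filter]
    exact (Finset.sum_subtype _ (by simp) (fun p : IB × IB => F p.1 p.2)).symm
  rw [h1, Fintype.sum_prod_type, ← Finset.sum_sub_distrib]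
  refine Finset.sum_congr rfl fun y _ => ?_
  have : ∀ z, (if y ≠ z then F y z else 0) = F y z - if y = z then F y z else 0 := by
    intro z; by_cases h : y = z <;> simp [h]
  simp only [this, Finset.sum_sub_distrib]
  simp

lemma core {IB R : Type} [Fintype IB] [DecidableEq IB] [Ring R] [Algebra ℝ R] (L : R →ₗ[ℝ] ℝ)
    (E : IB → R)
    (h1 : ∀ y z (t : ℝ), 0 ≤ L ((E y - t • (1 : R)) * E z * (E y - t • (1 : R))))
    (h2 : ∀ t : ℝ, 0 ≤ L ((∑ y, E y - t • (1 : R)) * (∑ y, E y - t • (1 : R))))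
    (h3 : ∀ y, L (E y * E y) ≤ L (E y))
    (X n w : ℝ) (hX : 0 < X) (hL : L 1 = X) (hn : n = Fintype.card IB) (hn2 : 2 ≤ n)
    (hw : ∑ y, L (E y) = X * n * w) (hw1 : 1 / n ≤ w) :
    X * n ^ 3 / (n - 1) * w * (w - 1 / n) ^ 2 ≤
      ∑ p : {p : IB × IB // p.1 ≠ p.2}, L (E p.1.1 * E p.1.2 * E p.1.1) := by
  set M := ∑ y, E y with hM
  have hLM : L M = X * n * w := by rw [hM, map_sum, hw]
  have hD : X * n ^ 2 * w ^ 2 ≤ L (M * M) := by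
    have := h2 (n * w)
    simp only [sub_mul, mul_sub, smul_mul_assoc, mul_smul_comm, mul_one, one_mul, map_sub,
      map_smul, hLM, hL, smul_eq_mul] at this
    nlinarith
  have hMM : L (M * M) = ∑ y, ∑ z, L (E y * E z) := by
    rw [hM, Finset.sum_mul_sum]; simp only [map_sum]
  have hC : X * n ^ 2 * w ^ 2 - X * n * w ≤
      ∑ p : {p : IB × IB // p.1 ≠ p.2}, L (E p.1.1 * E p.1.2) := by
    rw [sum_ne_eq (fun y z => L (E y * E z)), ← hMM]
    have := Finset.sum_le_sum (fun y (_ : y ∈ Finset.univ) => h3 y)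
    linarith
  have hC' : ∑ p : {p : IB × IB // p.1 ≠ p.2}, L (E p.1.2 * E p.1.1)
      = ∑ p : {p : IB × IB // p.1 ≠ p.2}, L (E p.1.1 * E p.1.2) := by
    rw [sum_ne_eq (fun y z => L (E y * E z)), sum_ne_eq (fun y z => L (E z * E y)),
      Finset.sum_comm]
  have hP : ∑ p : {p : IB × IB // p.1 ≠ p.2}, L (E p.1.2) = (n - 1) * (X * n * w) := by
    rw [sum_ne_eq (fun y z => L (E z)), ← hw]
    simp [hn]; ring
  set C := ∑ p : {p : IB × IB // p.1 ≠ p.2}, L (E p.1.1 * E p.1.2) with hCdef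
  set S := ∑ p : {p : IB × IB // p.1 ≠ p.2}, L (E p.1.1 * E p.1.2 * E p.1.1) with hS
  have key : ∀ t : ℝ, 0 ≤ S - 2 * t * C + t ^ 2 * ((n - 1) * (X * n * w)) := by
    intro t
    have := Finset.sum_nonneg (s := (Finset.univ : Finset {p : IB × IB // p.1 ≠ p.2}))
      (fun p _ => h1 p.1.1 p.1.2 t)
    have e : ∀ y z, L ((E y - t • (1 : R)) * E z * (E y - t • (1 : R)))
        = L (E y * E z * E y) - t * L (E y * E z) - t * L (E z * E y) + t ^ 2 * L (E z) := by
      intro y z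
      simp only [sub_mul, mul_sub, smul_mul_assoc, mul_smul_comm, mul_one, one_mul, map_sub,
        map_smul, smul_eq_mul]
      ring
    simp only [e, Finset.sum_add_distrib, Finset.sum_sub_distrib, ← Finset.mul_sum] at this
    rw [hC', hP, ← hS, ← hCdef] at this
    linarith
  have hn0 : 0 < n := by linarith
  have hn1 : 0 < n - 1 := by linarith
  have hnw : 0 ≤ n * w - 1 := by
    rw [div_le_iff₀ hn0] at hw1; linarith
  have k := key ((n * w - 1) / (n - 1))
  have ht : 0 ≤ (n * w - 1) / (n - 1) := by positivity
  have k2 := mul_le_mul_of_nonneg_left hC ht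
  have e : X * n ^ 3 / (n - 1) * w * (w - 1 / n) ^ 2
      = 2 * ((n * w - 1) / (n - 1) * (X * n ^ 2 * w ^ 2 - X * n * w))
        - ((n * w - 1) / (n - 1)) ^ 2 * ((n - 1) * (X * n * w)) := by
    field_simp
    ring
  rw [e]; linarith

section
variable {IA IB OA OB : Type} [Fintype IA] [Fintype IB] [Fintype OA] [Fintype OB]

open scoped MatrixOrder Matrix.Norms.L2Operator in
lemma trace_mul_nonneg {m : Type} [Fintype m] [DecidableEq m] {A B : Matrix m m ℂ}
    (hA : A.PosSemidef) (hB : B.PosSemidef) : 0 ≤ ((A * B).trace).re := by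
  obtain ⟨C, rfl⟩ := CStarAlgebra.nonneg_iff_eq_star_mul_self.mp (Matrix.nonneg_iff_posSemidef.mpr hB)
  have h : (A * (Cᴴ * C)).trace = (C * A * Cᴴ).trace := by
    rw [← Matrix.mul_assoc, Matrix.trace_mul_comm, ← Matrix.mul_assoc]
  rw [Matrix.star_eq_conjTranspose, h]
  exact (Complex.le_def.mp (hA.mul_mul_conjTranspose_same C).trace_nonneg).1

/-- The bilinear functional of a strategy. -/
noncomputable def fS (S : Strategy IA IB OA OB) (x : IA) (a : OA) :
    Matrix (Fin S.dB) (Fin S.dB) ℂ →ₗ[ℝ] ℝ where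
  toFun A := (((S.Q x a ⊗ₖ A) * S.ρ).trace).re
  map_add' A B := by simp [Matrix.kronecker_add, Matrix.add_mul]
  map_smul' t A := by simp [Matrix.kronecker_smul, Matrix.smul_mul, Matrix.trace_smul]

lemma fS_nonneg (S : Strategy IA IB OA OB) (x : IA) (a : OA)
    {A : Matrix (Fin S.dB) (Fin S.dB) ℂ} (hA : A.PosSemidef) : 0 ≤ fS S x a A :=
  trace_mul_nonneg ((S.Q_psd x a).kronecker hA) S.ρ_psd

lemma sum_kron {ι m : Type} {l : Type} (s : Finset ι) (A : ι → Matrix m m ℂ) (B : Matrix l l ℂ) :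
    (∑ i ∈ s, A i) ⊗ₖ B = ∑ i ∈ s, A i ⊗ₖ B := by
  ext ⟨i, j⟩ ⟨k, l⟩
  simp [Matrix.kroneckerMap_apply, Matrix.sum_apply, Finset.sum_mul]

lemma fS_one (S : Strategy IA IB OA OB) (x : IA) : ∑ a, fS S x a 1 = 1 := by
  have : ∑ a, fS S x a 1 = ((((∑ a, S.Q x a) ⊗ₖ (1 : Matrix (Fin S.dB) (Fin S.dB) ℂ)) * S.ρ).trace).re := by
    rw [sum_kron, Matrix.sum_mul, Matrix.trace_sum, Complex.re_sum]; rfl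
  rw [this, S.Q_sum, Matrix.one_kronecker_one, Matrix.one_mul, S.ρ_tr]; simp

lemma winProb_eq (G : Game IA IB OA OB) (S : Strategy IA IB OA OB) :
    winProb G S = ((Fintype.card IA : ℝ) * (Fintype.card IB : ℝ))⁻¹ *
    ∑ x, ∑ y, ∑ a, ∑ b, if G.W x y a b then fS S x a (S.P y b) else 0 := rfl

lemma winProb_nonneg (G : Game IA IB OA OB) (S : Strategy IA IB OA OB) : 0 ≤ winProb G S := by
  rw [winProb_eq]
  refine mul_nonneg (by positivity) ?_
  refine Finset.sum_nonneg fun x _ => Finset.sum_nonneg fun y _ => Finset.sum_nonneg fun a _ =>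
    Finset.sum_nonneg fun b _ => ?_
  split_ifs
  · exact fS_nonneg S x a (S.P_psd y b)
  · exact le_rfl

lemma winProb_le_one (G : Game IA IB OA OB) (S : Strategy IA IB OA OB) : winProb G S ≤ 1 := by
  rw [winProb_eq]
  refine inv_mul_le_one_of_le₀ ?_ (by positivity)
  calc _ ≤ ∑ x : IA, ∑ y : IB, (1 : ℝ) := by
        refine Finset.sum_le_sum fun x _ => Finset.sum_le_sum fun y _ => ?_
        calc _ ≤ ∑ a, ∑ b, fS S x a (S.P y b) := by
              refine Finset.sum_le_sum fun a _ => Finset.sum_le_sum fun b _ => ?_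
              split_ifs
              · exact le_rfl
              · exact fS_nonneg S x a (S.P_psd y b)
          _ = 1 := by simp only [← map_sum, S.P_sum, fS_one]
    _ = _ := by simp

lemma P_compl (S : Strategy IA IB OA OB) (y : IB) (b : OB) : (1 - S.P y b).PosSemidef := by
  classical
  rw [← S.P_sum y, ← Finset.sum_erase_eq_sub (Finset.mem_univ b)]
  exact Matrix.posSemidef_sum _ fun i _ => S.P_psd y i

lemma P_sq (S : Strategy IA IB OA OB) (y : IB) (b : OB) :
    (S.P y b - S.P y b * S.P y b).PosSemidef := by
  have h1 := (P_compl S y b).mul_mul_conjTranspose_same (S.P y b)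
  have h2 := (S.P_psd y b).mul_mul_conjTranspose_same (1 - S.P y b)
  rw [(S.P_psd y b).isHermitian.eq] at h1
  rw [(P_compl S y b).isHermitian.eq] at h2
  convert h1.add h2 using 1
  noncomm_ring

lemma OB_card_ne (S : Strategy IA IB OA OB) (y : IB) : (Fintype.card OB : ℝ) ≠ 0 := by
  intro h
  have h' : Fintype.card OB = 0 := by exact_mod_cast h
  haveI := Fintype.card_eq_zero_iff.mp h'
  have h1 := S.P_sum y
  rw [Finset.univ_eq_empty, Finset.sum_empty] at h1
  have h2 := S.ρ_tr
  rw [← Matrix.one_mul S.ρ, ← Matrix.one_kronecker_one, ← h1] at h2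
  simp at h2

/-- The consecutive-measurement strategy. -/
noncomputable def cpS [DecidableEq IB] (S : Strategy IA IB OA OB) :
    Strategy IA {p : IB × IB // p.1 ≠ p.2} OA (OB × OB) where
  dA := S.dA
  dB := S.dB
  ρ := S.ρ
  ρ_psd := S.ρ_psd
  ρ_tr := S.ρ_tr
  Q := S.Q
  Q_psd := S.Q_psd
  Q_sum := S.Q_sum
  P y b := S.P y.1.1 b.1 * S.P y.1.2 b.2 * S.P y.1.1 b.1 +
    ((Fintype.card OB : ℝ)⁻¹) • (S.P y.1.1 b.1 - S.P y.1.1 b.1 * S.P y.1.1 b.1)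
  P_psd y b := by
    have h := (S.P_psd y.1.2 b.2).mul_mul_conjTranspose_same (S.P y.1.1 b.1)
    rw [(S.P_psd y.1.1 b.1).isHermitian.eq] at h
    exact h.add ((P_sq S _ _).smul (by positivity))
  P_sum y := by
    have h0 := OB_card_ne S y.1.1
    rw [Fintype.sum_prod_type, ← S.P_sum y.1.1]
    refine Finset.sum_congr rfl fun b _ => ?_
    simp only [Finset.sum_add_distrib, ← Finset.sum_mul, ← Finset.mul_sum, S.P_sum]
    rw [Finset.sum_const, Finset.card_univ, ← Nat.cast_smul_eq_nsmul ℝ, smul_smul,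
      mul_inv_cancel₀ h0]
    simp

lemma cp_ge [DecidableEq IB] (G : Game IA IB OA OB) (hproj : G.Projective)
    (n : ℕ) (hn : n = Fintype.card IB) (hn2 : 2 ≤ n) (S : Strategy IA IB OA OB) :
    ((n : ℝ) ^ 2 / ((n : ℝ) - 1) ^ 2) * winProb G S *
        (max 0 (winProb G S - 1 / (n : ℝ))) ^ 2 ≤ winProb G.coupled (cpS S) := by
  rcases le_total (winProb G S) (1 / (n : ℝ)) with hle | hge
  · rw [max_eq_left (by linarith)]
    simpa using winProb_nonneg G.coupled (cpS S)
  rw [max_eq_right (by linarith)]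
  have hnR : (2 : ℝ) ≤ n := by exact_mod_cast hn2
  have hX : 0 < (Fintype.card IA : ℝ) := by
    rcases Nat.eq_zero_or_pos (Fintype.card IA) with h | h
    · exfalso
      have : winProb G S = 0 := by simp [winProb_eq, h]
      rw [this] at hge
      have : 0 < 1 / (n : ℝ) := by positivity
      linarith
    · exact_mod_cast h
  choose β hβ hβ' using hproj
  let L : (IA → OA → Matrix (Fin S.dB) (Fin S.dB) ℂ) →ₗ[ℝ] ℝ :=
    { toFun := fun A => ∑ x, ∑ a, fS S x a (A x a)
      map_add' := fun A B => by simp [Finset.sum_add_distrib]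
      map_smul' := fun t A => by simp [Finset.mul_sum] }
  have hLdef : ∀ A, L A = ∑ x, ∑ a, fS S x a (A x a) := fun A => rfl
  have hLnn : ∀ A : IA → OA → Matrix (Fin S.dB) (Fin S.dB) ℂ,
      (∀ x a, (A x a).PosSemidef) → 0 ≤ L A := fun A hA =>
    Finset.sum_nonneg fun x _ => Finset.sum_nonneg fun a _ => fS_nonneg S x a (hA x a)
  let E : IB → IA → OA → Matrix (Fin S.dB) (Fin S.dB) ℂ := fun y x a => S.P y (β x y a)
  have hherm : ∀ (A : Matrix (Fin S.dB) (Fin S.dB) ℂ) (t : ℝ), A.IsHermitian →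
      (A - t • (1 : Matrix (Fin S.dB) (Fin S.dB) ℂ))ᴴ = A - t • 1 := by
    intro A t hA
    rw [Matrix.conjTranspose_sub, hA.eq, Matrix.conjTranspose_smul, Matrix.conjTranspose_one]
    simp
  have hwin : ∀ x y a, (∑ b, if G.W x y a b then fS S x a (S.P y b) else 0)
      = fS S x a (E y x a) := by
    intro x y a
    rw [Finset.sum_eq_single (β x y a)]
    · simp [hβ x y a, E]
    · intro b _ hb
      rw [if_neg]
      intro h; exact hb (hβ' x y a b h)
    · simp
  have hw : ∑ y, L (E y) = Fintype.card IA * n * winProb G S := by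
    rw [winProb_eq, hn, mul_inv_cancel_left₀ (by rw [← hn]; positivity)]
    simp only [hwin, hLdef]
    exact Finset.sum_comm
  have hc := core L E ?_ ?_ ?_ (Fintype.card IA) n (winProb G S) hX ?_ (by rw [hn]) hnR hw hge
  rotate_left
  · intro y z t
    refine hLnn _ fun x a => ?_
    have h := (S.P_psd z (β x z a)).mul_mul_conjTranspose_same (S.P y (β x y a) - t • 1)
    rw [hherm _ t (S.P_psd y (β x y a)).isHermitian] at h
    exact h
  · intro t
    refine hLnn _ fun x a => ?_
    have hs : (∑ y, S.P y (β x y a)).IsHermitian :=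
      (Matrix.posSemidef_sum _ fun y _ => S.P_psd y (β x y a)).isHermitian
    have h := Matrix.posSemidef_self_mul_conjTranspose (∑ y, S.P y (β x y a) - t • 1)
    rw [hherm _ t hs] at h
    have e : (∑ y, E y) x a = ∑ y, S.P y (β x y a) := by simp [Finset.sum_apply, E]
    rw [← e] at h
    exact h
  · intro y
    rw [← sub_nonneg, ← map_sub]
    exact hLnn _ fun x a => P_sq S y (β x y a)
  · rw [hLdef]
    simp [fS_one]
  have hcard : (Fintype.card {p : IB × IB // p.1 ≠ p.2} : ℝ) = n * (n - 1) := by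
    have h := sum_ne_eq (IB := IB) (fun _ _ => 1)
    rw [Finset.sum_const, Finset.card_univ, nsmul_one] at h
    rw [h]
    simp [← hn]
    ring
  have hlow : ∑ p : {p : IB × IB // p.1 ≠ p.2}, L (E p.1.1 * E p.1.2 * E p.1.1) ≤
      ∑ x, ∑ y, ∑ a, ∑ b, if G.coupled.W x y a b then fS (cpS S) x a ((cpS S).P y b) else 0 := by
    simp only [hLdef]
    rw [Finset.sum_comm]
    refine Finset.sum_le_sum fun x _ => Finset.sum_le_sum fun p _ => Finset.sum_le_sum fun a _ => ?_
    have hnn : ∀ b ∈ (Finset.univ : Finset (OB × OB)),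
        0 ≤ if G.coupled.W x p a b then fS (cpS S) x a ((cpS S).P p b) else 0 := by
      intro b _
      split_ifs
      · exact fS_nonneg _ x a ((cpS S).P_psd p b)
      · exact le_rfl
    refine le_trans ?_ (Finset.single_le_sum hnn
      (Finset.mem_univ ((β x p.1.1 a, β x p.1.2 a) : OB × OB)))
    rw [if_pos (by simp [Game.coupled, hβ x p.1.1 a, hβ x p.1.2 a])]
    have hr : 0 ≤ fS S x a (((Fintype.card OB : ℝ)⁻¹) • (S.P p.1.1 (β x p.1.1 a)
        - S.P p.1.1 (β x p.1.1 a) * S.P p.1.1 (β x p.1.1 a))) :=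
      fS_nonneg S x a ((P_sq S _ _).smul (by positivity))
    have he : fS (cpS S) x a ((cpS S).P p (β x p.1.1 a, β x p.1.2 a))
        = fS S x a (E p.1.1 x a * E p.1.2 x a * E p.1.1 x a +
          ((Fintype.card OB : ℝ)⁻¹) • (S.P p.1.1 (β x p.1.1 a)
        - S.P p.1.1 (β x p.1.1 a) * S.P p.1.1 (β x p.1.1 a))) := rfl
    rw [he, map_add]
    exact le_add_of_nonneg_right hr
  rw [winProb_eq G.coupled, hcard]
  have hn0 : (0 : ℝ) < n := by linarith
  have hn1 : (0 : ℝ) < n - 1 := by linarith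
  refine le_trans (le_of_eq ?_) (mul_le_mul_of_nonneg_left (hc.trans hlow) (by positivity))
  field_simp

lemma bdd_win (G : Game IA IB OA OB) :
    BddAbove {w : ℝ | ∃ S : Strategy IA IB OA OB, w = winProb G S} :=
  ⟨1, by rintro _ ⟨S, rfl⟩; exact winProb_le_one G S⟩

end

/-- Coupled game value bound from the tight consecutive measurement theorem. -/
theorem coupled_game_value {IA IB OA OB : Type}
    [Fintype IA] [Fintype IB] [Fintype OA] [Fintype OB] [DecidableEq IB]
    (G : Game IA IB OA OB) (hproj : G.Projective)
    (n : ℕ) (hn : n = Fintype.card IB) (hn2 : 2 ≤ n) :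
    qValue G.coupled ≥
      ((n : ℝ) ^ 2 / ((n : ℝ) - 1) ^ 2) * qValue G *
        (max 0 (qValue G - 1 / (n : ℝ))) ^ 2 := by
  rcases Set.eq_empty_or_nonempty {w : ℝ | ∃ S : Strategy IA IB OA OB, w = winProb G S} with h | h
  · have h0 : qValue G = 0 := by rw [qValue, h, Real.sSup_empty]
    rw [h0]
    simp only [mul_zero, zero_mul, ge_iff_le]
    refine Real.sSup_nonneg ?_
    rintro _ ⟨S, rfl⟩
    exact winProb_nonneg _ S
  · obtain ⟨u, -, hu, hmem⟩ := exists_seq_tendsto_sSup h (bdd_win G)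
    have hcont : Continuous fun w : ℝ => ((n : ℝ) ^ 2 / ((n : ℝ) - 1) ^ 2) * w *
        (max 0 (w - 1 / (n : ℝ))) ^ 2 := by fun_prop
    refine le_of_tendsto' ((hcont.tendsto _).comp hu) fun k => ?_
    obtain ⟨S, hS⟩ := hmem k
    simp only [Function.comp, hS]
    exact (cp_ge G hproj n hn hn2 S).trans (le_csSup (bdd_win G.coupled) ⟨cpS S, rfl⟩)
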